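/- arXiv:2109.08606 — 3 statements merged into one kernel-verified Lean document; each statement's English description precedes it below -/
import Mathlib

section
/- Let M be a von Neumann algebra, p, q projections in M, and suppose ν(p) = ν(q) < ∞ for every normal tracial weight (equivalently, every normal tracial positive functional) ν on M. If M admits a faithful normal tracial weight τ and ν ranges over all normal traces ν ≤ τ, and ν(p) = ν(q) for all such ν, then p and q are Murray–von Neumann equivalent in M. -/
open scoped NNReal ENNReal

/-- A normal tracial weight on a von Neumann algebra `M ⊆ B(H)`: an additive, positively
homogeneous, tracial map on the positive cone of `M` which is normal, i.e. respects suprema of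
monotone nets of positive operators converging in the weak operator topology. -/
structure NormalTracialWeight {H : Type*} [NormedAddCommGroup H] [InnerProductSpace ℂ H]
    [CompleteSpace H] (M : VonNeumannAlgebra H) where
  toFun : (H →L[ℂ] H) → ℝ≥0∞
  additive : ∀ x y : H →L[ℂ] H, x ∈ M → y ∈ M → 0 ≤ x → 0 ≤ y →
    toFun (x + y) = toFun x + toFun y
  homog : ∀ (r : ℝ≥0) (x : H →L[ℂ] H), x ∈ M → 0 ≤ x →
    toFun (((r : ℝ) : ℂ) • x) = r * toFun x
  tracial : ∀ x : H →L[ℂ] H, x ∈ M → toFun (star x * x) = toFun (x * star x)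
  normal : ∀ (ι : Type) [Preorder ι] [IsDirected ι (· ≤ ·)] [Nonempty ι]
    (f : ι → (H →L[ℂ] H)) (L : H →L[ℂ] H), Monotone f → (∀ i, f i ∈ M ∧ 0 ≤ f i) →
    L ∈ M → 0 ≤ L →
    (∀ ξ η : H, Filter.Tendsto (fun i => (inner (𝕜 := ℂ) ξ (f i η)))
      Filter.atTop (nhds (inner (𝕜 := ℂ) ξ (L η)))) →
    toFun L = ⨆ i, toFun (f i)

open scoped InnerProductSpace in
/-- The set of contractions `v ∈ M` with `q v p = v` has an extreme point: as a set of sesquilinear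
forms it is compact for the topology of pointwise convergence. -/
theorem VonNeumannAlgebra.exists_extreme_contraction {H : Type*} [NormedAddCommGroup H]
    [InnerProductSpace ℂ H] [CompleteSpace H] (M : VonNeumannAlgebra H) (p q : H →L[ℂ] H)
    (hq : IsSelfAdjoint q) :
    ∃ v ∈ M, q * v * p = v ∧ ‖v‖ ≤ 1 ∧ ∀ y ∈ M, q * y * p = y →
      ‖v + y‖ ≤ 1 → ‖v - y‖ ≤ 1 → y = 0 := by
  let T : (H →L[ℂ] H) → H → H → ℂ := fun v ξ η => ⟪ξ, v η⟫_ℂ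
  have T_inj : Function.Injective T := fun v w hvw =>
    ContinuousLinearMap.ext fun η => ext_inner_left ℂ fun ξ => congrFun (congrFun hvw ξ) η
  let K : Set (H →L[ℂ] H) := {v | v ∈ M ∧ q * v * p = v ∧ ‖v‖ ≤ 1}
  let C : Set (H → H → ℂ) := {F |
    (∀ ξ η ζ, F (ξ + η) ζ = F ξ ζ + F η ζ) ∧
    (∀ ξ η ζ, F ξ (η + ζ) = F ξ η + F ξ ζ) ∧
    (∀ (c : ℂ) ξ η, F (c • ξ) η = star c * F ξ η) ∧
    (∀ (c : ℂ) ξ η, F ξ (c • η) = c * F ξ η) ∧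
    (∀ x ∈ M.commutant, ∀ ξ η, F ξ (x η) = F (star x ξ) η) ∧
    (∀ ξ η, F (q ξ) (p η) = F ξ η) ∧
    (∀ ξ η, ‖F ξ η‖ ≤ ‖ξ‖ * ‖η‖)}
  have hTK : T '' K = C := by
    ext F
    constructor
    · rintro ⟨v, ⟨hvM, hv, hv1⟩, rfl⟩
      refine ⟨fun ξ η ζ => inner_add_left _ _ _, fun ξ η ζ => ?_, fun c ξ η => inner_smul_left _ _ _,
        fun c ξ η => ?_, fun x hx ξ η => ?_, fun ξ η => ?_, fun ξ η => ?_⟩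
      · simp [T]
      · simp [T]
      · have := VonNeumannAlgebra.mem_commutant_iff.mp hx v hvM
        have h2 : v (x η) = x (v η) := congr($this η)
        simp only [T, h2, ContinuousLinearMap.star_eq_adjoint,
          ContinuousLinearMap.adjoint_inner_left]
      · have h2 : q (v (p η)) = v η := congr($hv η)
        have h3 : ContinuousLinearMap.adjoint q = q := hq
        simp only [T]
        rw [← h2, ← ContinuousLinearMap.adjoint_inner_left q, h3]
      · refine (norm_inner_le_norm _ _).trans ?_
        gcongr
        simpa using v.le_of_opNorm_le hv1 η
    · rintro ⟨h1, h2, h3, h4, h5, h6, h7⟩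
      let B : H →L⋆[ℂ] H →L[ℂ] ℂ :=
        LinearMap.mkContinuous₂ (LinearMap.mk₂'ₛₗ (starRingEnd ℂ) (RingHom.id ℂ) F h1
          (fun c ξ η => by simpa using h3 c ξ η) h2 (fun c ξ η => by simpa using h4 c ξ η)) 1
          (fun ξ η => by simpa using h7 ξ η)
      have hB : ∀ ξ η, B ξ η = F ξ η := fun _ _ => rfl
      let v : H →L[ℂ] H := ContinuousLinearMap.adjoint
        (InnerProductSpace.continuousLinearMapOfBilin B)
      have hv : ∀ ξ η, ⟪ξ, v η⟫_ℂ = F ξ η := fun ξ η => by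
        simp only [v]
        rw [ContinuousLinearMap.adjoint_inner_right,
          InnerProductSpace.continuousLinearMapOfBilin_apply, hB]
      have hTv : T v = F := by
        funext ξ η
        exact hv ξ η
      refine ⟨v, ⟨?_, ?_, ?_⟩, hTv⟩
      · rw [← M.commutant_commutant, VonNeumannAlgebra.mem_commutant_iff]
        intro x hx
        refine ContinuousLinearMap.ext fun η => ext_inner_left ℂ fun ξ => ?_
        change ⟪ξ, x (v η)⟫_ℂ = ⟪ξ, v (x η)⟫_ℂ
        rw [hv, h5 x hx, ← hv, ContinuousLinearMap.star_eq_adjoint,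
          ContinuousLinearMap.adjoint_inner_left]
      · refine ContinuousLinearMap.ext fun η => ext_inner_left ℂ fun ξ => ?_
        change ⟪ξ, q (v (p η))⟫_ℂ = ⟪ξ, v η⟫_ℂ
        have h8 : ContinuousLinearMap.adjoint q = q := hq
        rw [← ContinuousLinearMap.adjoint_inner_left, h8, hv, hv, h6]
      · refine ContinuousLinearMap.opNorm_le_bound _ zero_le_one fun η => ?_
        have h8 := h7 (v η) η
        rw [← hv, inner_self_eq_norm_sq_to_K] at h8
        simp only [norm_pow, RCLike.norm_ofReal, abs_norm] at h8
        rcases (norm_nonneg (v η)).eq_or_lt with h0 | h0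
        · rw [← h0]; positivity
        · rw [one_mul]
          exact le_of_mul_le_mul_left (by rwa [← sq]) h0
  have hC_closed : IsClosed C := by
    have hc : ∀ ξ η : H, Continuous fun F : H → H → ℂ => F ξ η := fun ξ η =>
      continuous_apply_apply ξ η
    simp only [C, Set.ofPred_and, Set.ofPred_forall]
    refine IsClosed.inter ?_ (.inter ?_ (.inter ?_ (.inter ?_ (.inter ?_ (.inter ?_ ?_)))))
    all_goals
      repeat' refine isClosed_iInter fun _ => ?_
      first
      | exact isClosed_eq (by fun_prop) (by fun_prop)
      | exact isClosed_le (by fun_prop) (by fun_prop)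
  have hC_compact : IsCompact C := by
    refine (isCompact_univ_pi fun ξ : H => isCompact_univ_pi fun η : H =>
      isCompact_closedBall (0 : ℂ) (‖ξ‖ * ‖η‖)).of_isClosed_subset hC_closed ?_
    rintro F ⟨-, -, -, -, -, -, h7⟩ ξ - η -
    simpa using h7 ξ η
  have hC_nonempty : C.Nonempty := by
    rw [← hTK]
    exact ⟨T 0, 0, ⟨zero_mem M, by simp, by simp⟩, rfl⟩
  obtain ⟨F, hF⟩ := hC_compact.extremePoints_nonempty (E := H → H → ℂ) hC_nonempty
  rw [← hTK, mem_extremePoints] at hF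
  obtain ⟨⟨v, ⟨hvM, hv, hv1⟩, rfl⟩, hext⟩ := hF
  refine ⟨v, hvM, hv, hv1, fun y hyM hy hp hm => ?_⟩
  have hmem := hext (T (v + y)) ⟨v + y, ⟨add_mem hvM hyM, by rw [mul_add, add_mul, hv, hy], hp⟩, rfl⟩
    (T (v - y)) ⟨v - y, ⟨sub_mem hvM hyM, by rw [mul_sub, sub_mul, hv, hy], hm⟩, rfl⟩
    ⟨1 / 2, 1 / 2, by norm_num, by norm_num, by norm_num, by
      funext ξ η
      simp only [T, Pi.add_apply, Pi.smul_apply, add_apply,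
        sub_apply, inner_add_right, inner_sub_right, Complex.real_smul]
      push_cast
      ring⟩
  simpa using T_inj hmem.1

theorem norm_sub_half_smul_sub_le_one {A : Type*} [CStarAlgebra A] {v : A} (hv : ‖v‖ ≤ 1) :
    ‖v - (1 / 2 : ℝ) • (v - v * star v * v)‖ ≤ 1 := by
  have h : v - (1 / 2 : ℝ) • (v - v * star v * v) = (1 / 2 : ℝ) • (v + v * star v * v) := by
    module
  have h3 : ‖v * star v * v‖ ≤ 1 := by
    refine (norm_mul_le _ _).trans (mul_le_one₀ ((norm_mul_le _ _).trans ?_) (norm_nonneg _) hv)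
    rw [norm_star]
    exact mul_le_one₀ hv (norm_nonneg _) hv
  rw [h, norm_smul]
  have := norm_add_le v (v * star v * v)
  norm_num
  linarith

theorem norm_add_half_smul_sub_le_one {A : Type*} [CStarAlgebra A] [PartialOrder A]
    [StarOrderedRing A] {v : A} (hv : ‖v‖ ≤ 1) :
    ‖v + (1 / 2 : ℝ) • (v - v * star v * v)‖ ≤ 1 := by
  set s := 1 - star v * v with hs
  have hs0 : 0 ≤ s := by
    rw [hs, sub_nonneg, ← CStarAlgebra.norm_le_one_iff_of_nonneg _ (star_mul_self_nonneg v),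
      CStarRing.norm_star_mul_self]
    exact mul_le_one₀ hv (norm_nonneg _) hv
  have hsa : star s = s := (IsSelfAdjoint.of_nonneg hs0).star_eq
  set w := v + (1 / 2 : ℝ) • (v - v * star v * v) with hw
  have hws : w = v * (1 + (1 / 2 : ℝ) • s) := by
    rw [hw, hs]
    simp only [mul_add, mul_sub, mul_one, mul_smul_comm, mul_assoc]
  have key : 1 - star w * w = (3 / 4 : ℝ) • (star s * s) + (1 / 4 : ℝ) • (star s * s * s) := by
    have hvv : star v * v = 1 - s := by rw [hs]; abel
    have : star w * w = (1 + (1 / 2 : ℝ) • s) * (1 - s) * (1 + (1 / 2 : ℝ) • s) := by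
      rw [hws, star_mul, star_add, star_one, star_smul, hsa, ← hvv]
      simp [mul_assoc]
    rw [this, hsa]
    simp only [mul_add, add_mul, mul_sub, sub_mul, mul_one, one_mul, mul_smul_comm, smul_mul_assoc,
      smul_add, smul_sub, smul_smul]
    module
  have hle : star w * w ≤ 1 := by
    rw [← sub_nonneg, key]
    have h3 : 0 ≤ star s * s * s := by
      have := star_left_conjugate_nonneg hs0 s
      exact this
    exact add_nonneg (smul_nonneg (by norm_num) (star_mul_self_nonneg s))
      (smul_nonneg (by norm_num) h3)
  rw [← CStarAlgebra.norm_le_one_iff_of_nonneg _ (star_mul_self_nonneg w),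
    CStarRing.norm_star_mul_self] at hle
  nlinarith [norm_nonneg w]

/-- If `v` is a partial isometry and `y` is a contraction whose support and range are orthogonal
to those of `v`, then `v + y` is a contraction. -/
theorem norm_add_le_one_of_orthogonal {A : Type*} [CStarAlgebra A] [PartialOrder A]
    [StarOrderedRing A] {v y : A} (hv : v * star v * v = v) (hy : ‖y‖ ≤ 1)
    (hvy : star v * y = 0) (hyv : y * star v = 0) : ‖v + y‖ ≤ 1 := by
  set e := 1 - star v * v with he
  have hye : y * e = y := by rw [he, mul_sub, mul_one, ← mul_assoc, hyv, zero_mul, sub_zero]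
  have hes : star e = e := by rw [he]; simp
  have hee : star e * e = e := by
    have : star v * v * (star v * v) = star v * v := by
      rw [mul_assoc, ← mul_assoc v, hv]
    rw [hes, he, mul_sub, sub_mul, sub_mul, this]
    simp
  have hyy : star y * y ≤ 1 := by
    rw [← CStarAlgebra.norm_le_one_iff_of_nonneg _ (star_mul_self_nonneg y),
      CStarRing.norm_star_mul_self]
    exact mul_le_one₀ hy (norm_nonneg _) hy
  have hyv' : star y * v = 0 := by simpa using congr(star $hvy)
  have hle : star (v + y) * (v + y) ≤ 1 := by
    have h1 := star_left_conjugate_le_conjugate hyy e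
    have h2 : star e * (star y * y) * e = star y * y := by
      rw [← mul_assoc, ← star_mul, hye, mul_assoc, hye]
    rw [h2, mul_one, hee, he] at h1
    rw [star_add, add_mul, mul_add, mul_add, hvy, hyv', add_zero, zero_add]
    exact (add_le_add_right h1 _).trans (by simp)
  rw [← CStarAlgebra.norm_le_one_iff_of_nonneg _ (star_mul_self_nonneg _),
    CStarRing.norm_star_mul_self] at hle
  nlinarith [norm_nonneg (v + y)]

theorem VonNeumannAlgebra.real_smul_mem {H : Type*} [NormedAddCommGroup H]
    [InnerProductSpace ℂ H] [CompleteSpace H] (M : VonNeumannAlgebra H) (r : ℝ) {x : H →L[ℂ] H}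
    (hx : x ∈ M) : r • x ∈ M := by
  have : (r : ℂ) • x ∈ M.toStarSubalgebra := SMulMemClass.smul_mem (r : ℂ) hx
  have h2 : (r : ℂ) • x = r • x := by ext; simp
  rwa [h2] at this

/-- Any two projections of a von Neumann algebra dominate the source and range of a partial isometry
whose complements in them are centrally orthogonal. -/
theorem VonNeumannAlgebra.exists_maximal_partialIsometry {H : Type*} [NormedAddCommGroup H]
    [InnerProductSpace ℂ H] [CompleteSpace H] (M : VonNeumannAlgebra H) {p q : H →L[ℂ] H}
    (hp_mem : p ∈ M) (hq_mem : q ∈ M) (hp : IsStarProjection p) (hq : IsStarProjection q) :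
    ∃ v ∈ M, v * star v * v = v ∧ q * v = v ∧ v * p = v ∧
      ∀ x ∈ M, (q - v * star v) * x * (p - star v * v) = 0 := by
  have hpp : p * p = p := hp.isIdempotentElem
  have hqq : q * q = q := hq.isIdempotentElem
  have hps : star p = p := hp.isSelfAdjoint
  have hqs : star q = q := hq.isSelfAdjoint
  obtain ⟨v, hvM, hv, hv1, hext⟩ := M.exists_extreme_contraction p q hq.isSelfAdjoint
  have hqv : q * v = v := by rw [← hv, ← mul_assoc, ← mul_assoc, hqq]
  have hvp : v * p = v := by rw [← hv, mul_assoc, hpp]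
  have hvs : star v ∈ M := star_mem hvM
  have hpv : p * star v = star v := by simpa [hps] using congr(star $hvp)
  have hvq : star v * q = star v := by simpa [hqs] using congr(star $hqv)
  have hvvv : v * star v * v = v := by
    have := hext ((1 / 2 : ℝ) • (v - v * star v * v))
      (M.real_smul_mem _ (sub_mem hvM (mul_mem (mul_mem hvM hvs) hvM)))
      (by
        have h3 : q * (v * star v * v) * p = v * star v * v := by
          rw [← mul_assoc, ← mul_assoc, hqv, mul_assoc, hvp]
        rw [mul_smul_comm, smul_mul_assoc, mul_sub, sub_mul, hqv, hvp, h3])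
      (norm_add_half_smul_sub_le_one hv1) (norm_sub_half_smul_sub_le_one hv1)
    rw [smul_eq_zero_iff_right (by norm_num), sub_eq_zero] at this
    exact this.symm
  refine ⟨v, hvM, hvvv, hqv, hvp, fun x hx => ?_⟩
  set y := (q - v * star v) * x * (p - star v * v) with hy
  have hyM : y ∈ M := mul_mem (mul_mem (sub_mem hq_mem (mul_mem hvM hvs)) hx)
    (sub_mem hp_mem (mul_mem hvs hvM))
  have hvvs : star v * v * star v = star v := by simpa [mul_assoc] using congr(star $hvvv)
  have hvy : star v * y = 0 := by
    have h1 : star v * (q - v * star v) = 0 := by rw [mul_sub, hvq, ← mul_assoc, hvvs, sub_self]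
    rw [hy, ← mul_assoc, ← mul_assoc, h1, zero_mul, zero_mul]
  have hyv : y * star v = 0 := by
    have h1 : (p - star v * v) * star v = 0 := by rw [sub_mul, hpv, hvvs, sub_self]
    rw [hy, mul_assoc, h1, mul_zero]
  have hqyp : q * y * p = y := by
    have h1 : q * (q - v * star v) = q - v * star v := by rw [mul_sub, hqq, ← mul_assoc, hqv]
    have h2 : (p - star v * v) * p = p - star v * v := by rw [sub_mul, hpp, mul_assoc, hvp]
    rw [hy, mul_assoc, mul_assoc, h2, ← mul_assoc, ← mul_assoc, h1]
  by_contra hy0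
  have hn : 0 < ‖y‖ := norm_pos_iff.mpr hy0
  set t := ‖y‖⁻¹ • y with ht
  have ht1 : ‖t‖ ≤ 1 := by
    rw [ht, norm_smul, norm_inv, norm_norm, inv_mul_cancel₀ hn.ne']
  have hvt : star v * t = 0 := by rw [ht, mul_smul_comm, hvy, smul_zero]
  have htv : t * star v = 0 := by rw [ht, smul_mul_assoc, hyv, smul_zero]
  have h0 := hext t (M.real_smul_mem _ hyM) (by rw [ht, mul_smul_comm, smul_mul_assoc, hqyp])
    (norm_add_le_one_of_orthogonal hvvv ht1 hvt htv)
    (by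
      rw [sub_eq_add_neg]
      exact norm_add_le_one_of_orthogonal hvvv (by rwa [norm_neg]) (by rw [mul_neg, hvt, neg_zero])
        (by rw [neg_mul, htv, neg_zero]))
  rw [ht, smul_eq_zero_iff_right (inv_ne_zero hn.ne')] at h0
  exact hy0 h0

/-- Every element `a` has a central projection `z` with `z a = a` which is annihilated by every
`b` with `b M a = 0`. -/
theorem VonNeumannAlgebra.exists_central_support {H : Type*} [NormedAddCommGroup H]
    [InnerProductSpace ℂ H] [CompleteSpace H] (M : VonNeumannAlgebra H) {a : H →L[ℂ] H}
    (ha : a ∈ M) :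
    ∃ z : H →L[ℂ] H, IsStarProjection z ∧ z ∈ M ∧ z ∈ M.commutant ∧ z * a = a ∧
      ∀ b : H →L[ℂ] H, (∀ x ∈ M, b * x * a = 0) → b * z = 0 := by
  let S : Submodule ℂ H := Submodule.span ℂ {ζ | ∃ x ∈ M, ∃ ξ, x (a ξ) = ζ}
  let V := S.topologicalClosure
  have : CompleteSpace V := S.isClosed_topologicalClosure.completeSpace_coe
  have hrange : (V.starProjection : H →L[ℂ] H).range = V := V.range_starProjection
  have hmaps : ∀ y : H →L[ℂ] H, (∀ x ∈ M, ∀ ξ, y (x (a ξ)) ∈ S) →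
      V ∈ Module.End.invtSubmodule (y : H →ₗ[ℂ] H) := by
    intro y hy
    have h1 : S ≤ S.comap (y : H →ₗ[ℂ] H) := by
      refine Submodule.span_le.mpr ?_
      rintro _ ⟨x, hx, ξ, rfl⟩
      exact hy x hx ξ
    have h2 : Set.MapsTo y (closure (S : Set H)) (closure S) :=
      Set.MapsTo.closure (fun _ hs => h1 hs) y.continuous
    rw [Module.End.mem_invtSubmodule]
    exact fun ζ hζ => h2 hζ
  refine ⟨V.starProjection, isStarProjection_starProjection, ?_, ?_, ?_, fun b hb => ?_⟩
  · rw [VonNeumannAlgebra.IsStarProjection.mem_iff isStarProjection_starProjection, hrange]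
    refine fun y hy => hmaps y fun x hx ξ => Submodule.subset_span ⟨x, hx, y ξ, ?_⟩
    have h1 := VonNeumannAlgebra.mem_commutant_iff.mp hy _ (mul_mem hx ha)
    exact congr($h1 ξ)
  · rw [VonNeumannAlgebra.IsStarProjection.mem_iff isStarProjection_starProjection, hrange,
      M.commutant_commutant]
    exact fun y hy => hmaps y fun x hx ξ => Submodule.subset_span ⟨y * x, mul_mem hy hx, ξ, rfl⟩
  · ext ξ
    exact V.starProjection_eq_self_iff.mpr
      (S.le_topologicalClosure (Submodule.subset_span ⟨1, one_mem M, ξ, rfl⟩))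
  · have h1 : S ≤ b.ker := by
      refine Submodule.span_le.mpr ?_
      rintro _ ⟨x, hx, ξ, rfl⟩
      exact congr($(hb x hx) ξ)
    have h2 : V ≤ b.ker := S.topologicalClosure_minimal h1 b.isClosed_ker
    ext ξ
    exact h2 (V.starProjection_apply_mem ξ)

namespace NormalTracialWeight

variable {H : Type*} [NormedAddCommGroup H] [InnerProductSpace ℂ H] [CompleteSpace H]
  {M : VonNeumannAlgebra H}

theorem map_zero (τ : NormalTracialWeight M) : τ.toFun 0 = 0 := by
  simpa using τ.homog 0 0 (zero_mem M) le_rfl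

/-- The reduction of a normal tracial weight by a central projection. -/
noncomputable def reduce (τ : NormalTracialWeight M) (z : H →L[ℂ] H) (hz : IsStarProjection z)
    (hzM : z ∈ M) (hzM' : z ∈ M.commutant) : NormalTracialWeight M where
  toFun x := τ.toFun (star z * x * z)
  additive x y hx hy hx0 hy0 := by
    rw [mul_add, add_mul]
    exact τ.additive _ _ (mul_mem (mul_mem (star_mem hzM) hx) hzM)
      (mul_mem (mul_mem (star_mem hzM) hy) hzM) (star_left_conjugate_nonneg hx0 z)
      (star_left_conjugate_nonneg hy0 z)
  homog r x hx hx0 := by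
    rw [mul_smul_comm, smul_mul_assoc]
    exact τ.homog r _ (mul_mem (mul_mem (star_mem hzM) hx) hzM) (star_left_conjugate_nonneg hx0 z)
  tracial x hx := by
    have hzs : star z = z := hz.isSelfAdjoint
    have h1 := VonNeumannAlgebra.mem_commutant_iff.mp hzM' x hx
    have h2 := VonNeumannAlgebra.mem_commutant_iff.mp hzM' (star x) (star_mem hx)
    have h3 : star z * (star x * x) * z = star (x * z) * (x * z) := by
      simp only [star_mul, mul_assoc]
    have h4 : star z * (x * star x) * z = x * z * star (x * z) := by
      rw [star_mul, hzs, ← mul_assoc z, ← h1, mul_assoc, h2]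
    rw [h3, h4, τ.tracial _ (mul_mem hx hzM)]
  normal ι _ _ _ f L hf hfM hL hL0 hlim := by
    refine τ.normal ι (fun i => star z * f i * z) _
      (fun i j hij => star_left_conjugate_le_conjugate (hf hij) z)
      (fun i => ⟨mul_mem (mul_mem (star_mem hzM) (hfM i).1) hzM,
        star_left_conjugate_nonneg (hfM i).2 z⟩)
      (mul_mem (mul_mem (star_mem hzM) hL) hzM) (star_left_conjugate_nonneg hL0 z) fun ξ η => ?_
    simpa [ContinuousLinearMap.star_eq_adjoint, ContinuousLinearMap.adjoint_inner_right]
      using hlim (z ξ) (z η)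

theorem reduce_le (τ : NormalTracialWeight M) {z : H →L[ℂ] H} (hz : IsStarProjection z)
    (hzM : z ∈ M) (hzM' : z ∈ M.commutant) {x : H →L[ℂ] H} (hx : x ∈ M) (hx0 : 0 ≤ x) :
    (τ.reduce z hz hzM hzM').toFun x ≤ τ.toFun x := by
  have hzs : star z = z := hz.isSelfAdjoint
  have hzz : z * z = z := hz.isIdempotentElem
  have h1 := VonNeumannAlgebra.mem_commutant_iff.mp hzM' x hx
  have hcM : 1 - z ∈ M := sub_mem (one_mem M) hzM
  have hsum : x = star z * x * z + star (1 - z) * x * (1 - z) := by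
    have h2 : x * z * z = x * z := by rw [mul_assoc, hzz]
    simp only [star_sub, star_one, hzs, mul_sub, sub_mul, mul_one, one_mul, h2, ← h1]
    abel
  conv_rhs => rw [hsum]
  rw [τ.additive _ _ (mul_mem (mul_mem (star_mem hzM) hx) hzM)
    (mul_mem (mul_mem (star_mem hcM) hx) hcM) (star_left_conjugate_nonneg hx0 _)
    (star_left_conjugate_nonneg hx0 _)]
  exact le_self_add

end NormalTracialWeight

/-- Comparison step: in a von Neumann algebra `M` with a faithful normal semifinite tracial
weight `τ`, two projections `p, q` with finite trace which satisfy `ν(p) = ν(q)` for every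
normal tracial weight `ν ≤ τ` are Murray–von Neumann equivalent. -/
theorem stmt11 {H : Type*} [NormedAddCommGroup H] [InnerProductSpace ℂ H] [CompleteSpace H]
    (M : VonNeumannAlgebra H)
    (τ : NormalTracialWeight M)
    (hτ_faithful : ∀ x : H →L[ℂ] H, x ∈ M → 0 ≤ x → τ.toFun x = 0 → x = 0)
    (hτ_semifinite : ∀ x : H →L[ℂ] H, x ∈ M → 0 ≤ x → x ≠ 0 →
      ∃ y : H →L[ℂ] H, y ∈ M ∧ 0 ≤ y ∧ y ≤ x ∧ y ≠ 0 ∧ τ.toFun y < ⊤)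
    (p q : H →L[ℂ] H) (hp_mem : p ∈ M) (hq_mem : q ∈ M)
    (hp_proj : IsIdempotentElem p ∧ IsSelfAdjoint p)
    (hq_proj : IsIdempotentElem q ∧ IsSelfAdjoint q)
    (hp_fin : τ.toFun p < ⊤) (hq_fin : τ.toFun q < ⊤)
    (h : ∀ ν : NormalTracialWeight M,
      (∀ x : H →L[ℂ] H, x ∈ M → 0 ≤ x → ν.toFun x ≤ τ.toFun x) →
      ν.toFun p = ν.toFun q) :
    ∃ v : H →L[ℂ] H, v ∈ M ∧ star v * v = p ∧ v * star v = q := by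
  have hvsub : ∀ {e a : H →L[ℂ] H}, star e = e → e * e = e → star a = a → a * a = a →
      e * a = a → a * e = a → 0 ≤ e - a := by
    intro e a he hee ha haa hea hae
    have h1 : star (e - a) * (e - a) = e - a := by
      rw [star_sub, he, ha, mul_sub, sub_mul, sub_mul, hee, haa, hea, hae]
      abel
    exact h1 ▸ star_mul_self_nonneg (e - a)
  have hps : star p = p := hp_proj.2
  have hqs : star q = q := hq_proj.2
  obtain ⟨v, hvM, hvvv, hqv, hvp, hmax⟩ := M.exists_maximal_partialIsometry hp_mem hq_mem
    ⟨hp_proj.1, hp_proj.2⟩ ⟨hq_proj.1, hq_proj.2⟩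
  have hvs : star v ∈ M := star_mem hvM
  have hpv : p * star v = star v := by simpa [hps] using congr(star $hvp)
  have hvq : star v * q = star v := by simpa [hqs] using congr(star $hqv)
  set a := star v * v with ha
  set b := v * star v with hb
  have haM : a ∈ M := mul_mem hvs hvM
  have hbM : b ∈ M := mul_mem hvM hvs
  have ha0 : 0 ≤ a := star_mul_self_nonneg v
  have hb0 : 0 ≤ b := mul_star_self_nonneg v
  have hpa : 0 ≤ p - a := hvsub hps hp_proj.1 (by simp [ha])
    (by rw [ha, mul_assoc, ← mul_assoc v, hvvv]) (by rw [ha, ← mul_assoc, hpv])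
    (by rw [ha, mul_assoc, hvp])
  have hqb : 0 ≤ q - b := hvsub hqs hq_proj.1 (by simp [hb])
    (by rw [hb, ← mul_assoc, hvvv]) (by rw [hb, ← mul_assoc, hqv]) (by rw [hb, mul_assoc, hvq])
  have hpaM : p - a ∈ M := sub_mem hp_mem haM
  have hqbM : q - b ∈ M := sub_mem hq_mem hbM
  have hsplit : ∀ ν : NormalTracialWeight M, ν.toFun p = ν.toFun b + ν.toFun (p - a) ∧
      ν.toFun q = ν.toFun b + ν.toFun (q - b) := by
    intro ν
    constructor
    · rw [hb, ← ν.tracial v hvM, ← ha, ← ν.additive a _ haM hpaM ha0 hpa, add_sub_cancel]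
    · rw [← ν.additive b _ hbM hqbM hb0 hqb, add_sub_cancel]
  obtain ⟨z, hz, hzM, hzM', hza, hzb⟩ := M.exists_central_support hpaM
  have hle : ∀ x : H →L[ℂ] H, x ∈ M → 0 ≤ x →
      (τ.reduce z hz hzM hzM').toFun x ≤ τ.toFun x := fun x hx hx0 =>
    τ.reduce_le hz hzM hzM' hx hx0
  have hpa0 : p - a = 0 := by
    have h1 := h _ hle
    have hqfin := (hle q hq_mem (by simpa using add_nonneg hqb hb0)).trans_lt hq_fin
    have hz1 : (τ.reduce z hz hzM hzM').toFun (q - b) = 0 := by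
      change τ.toFun (star z * (q - b) * z) = 0
      rw [mul_assoc, hzb _ hmax, mul_zero, τ.map_zero]
    have hz2 : (τ.reduce z hz hzM hzM').toFun (p - a) = τ.toFun (p - a) := by
      change τ.toFun (star z * (p - a) * z) = _
      rw [hz.isSelfAdjoint.star_eq, hza, VonNeumannAlgebra.mem_commutant_iff.mp hzM' _ hpaM, hza]
    rw [(hsplit _).2, hz1, add_zero] at hqfin h1
    rw [(hsplit _).1, hz2] at h1
    exact hτ_faithful _ hpaM hpa (by
      simpa using (ENNReal.add_right_inj hqfin.ne).mp (h1.trans (add_zero _).symm))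
  have hqb0 : q - b = 0 := by
    have h1 := h τ fun _ _ _ => le_rfl
    rw [(hsplit τ).2] at hq_fin
    rw [(hsplit τ).1, (hsplit τ).2, hpa0, τ.map_zero] at h1
    exact hτ_faithful _ hqbM hqb
      ((ENNReal.add_right_inj (ENNReal.add_lt_top.mp hq_fin).1.ne).mp h1).symm
  exact ⟨v, hvM, (sub_eq_zero.mp hpa0).symm, (sub_eq_zero.mp hqb0).symm⟩
end

section
/- Two exterior equivalent twisted actions have *-isomorphic reduced twisted crossed products: if (α,u) and (β,v) are twisted actions of a discrete group Γ on A with β_s = Ad(w_s)∘α_s and v(s,t) = w_s α_s(w_t) u(s,t) w_{st}* for unitaries w_s ∈ M(A), then the unitary U on H ⊗ ℓ²Γ defined by U(ξ ⊗ δ_t) = π(w_{t⁻¹})ξ ⊗ δ_t satisfies U (A ⋊_{r,α,u} Γ) U* = A ⋊_{r,β,v} Γ, with Ad(U)∘π̃_α = π̃_β and U π̃_α(w_g) λ^u_g U* = λ^v_g. -/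
open scoped ComplexOrder

theorem lp.clm_ext_single {Γ H F : Type*} [DecidableEq Γ] [NormedAddCommGroup H] [NormedSpace ℂ H]
    [AddCommMonoid F] [Module ℂ F] [TopologicalSpace F] [T2Space F]
    {S T : lp (fun _ : Γ => H) 2 →L[ℂ] F}
    (h : ∀ (t : Γ) (ξ : H), S (lp.single 2 t ξ) = T (lp.single 2 t ξ)) : S = T :=
  lp.ext_continuousLinearMap (by simp) fun t => by
    ext ξ
    simpa using h t ξ

/-- The adjoint of a diagonal operator on `ℓ²(Γ, H)` is diagonal with the adjoint entries. -/
theorem lp.star_apply_single_of_diagonal {Γ H : Type*} [DecidableEq Γ] [NormedAddCommGroup H]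
    [InnerProductSpace ℂ H] [CompleteSpace H]
    {T : lp (fun _ : Γ => H) 2 →L[ℂ] lp (fun _ : Γ => H) 2} {D : Γ → H →L[ℂ] H}
    (hT : ∀ (t : Γ) (ξ : H), T (lp.single 2 t ξ) = lp.single 2 t (D t ξ)) (t : Γ) (ξ : H) :
    star T (lp.single 2 t ξ) = lp.single 2 t (star (D t) ξ) := by
  have hcoord : ∀ (f : lp (fun _ : Γ => H) 2) (s : Γ) (η : H),
      inner ℂ (lp.single (E := fun _ : Γ => H) 2 s η) f = inner ℂ η (f s) :=
    fun f s η => lp.inner_single_left s η f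
  refine lp.ext (funext fun s => ext_inner_left ℂ fun η => ?_)
  rw [← hcoord, ContinuousLinearMap.star_eq_adjoint,
    ContinuousLinearMap.adjoint_inner_right, hT, hcoord]
  by_cases hst : s = t
  · subst hst
    rw [lp.single_apply_self, lp.single_apply_self, ContinuousLinearMap.star_eq_adjoint,
      ContinuousLinearMap.adjoint_inner_right]
  · rw [lp.single_apply_ne _ _ _ hst, lp.single_apply_ne _ _ _ hst, inner_zero_right,
      inner_zero_right]

/-- Conjugation by a unitary carries the C⋆-algebra generated by `S` onto the one generated by the
conjugate of `S`. -/
theorem Unitary.image_conj_closure_adjoin {B : Type*} [CStarAlgebra B] {U : B}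
    (hU : U ∈ unitary B) {S T : Set B} (hST : (fun x => U * x * star U) '' S = T) :
    (fun x => U * x * star U) '' closure (NonUnitalStarAlgebra.adjoin ℂ S : Set B) =
      closure (NonUnitalStarAlgebra.adjoin ℂ T : Set B) := by
  have hinv₁ : star U * U = 1 := hU.1
  have hinv₂ : U * star U = 1 := hU.2
  let e : B ≃ₜ B :=
    { toFun := fun x => U * x * star U
      invFun := fun x => star U * x * U
      left_inv := fun x => by
        simp only [mul_assoc, hinv₁, mul_one]
        rw [← mul_assoc, hinv₁, one_mul]
      right_inv := fun x => by
        simp only [mul_assoc, hinv₂, mul_one]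
        rw [← mul_assoc, hinv₂, one_mul]
      continuous_toFun := by fun_prop
      continuous_invFun := by fun_prop }
  have himage := NonUnitalStarAlgHom.map_adjoin (R := ℂ) (Unitary.conjStarAlgAut ℂ B ⟨U, hU⟩) S
  have hS : Unitary.conjStarAlgAut ℂ B ⟨U, hU⟩ '' S = T := hST
  rw [hS] at himage
  rw [← himage, NonUnitalStarSubalgebra.coe_map]
  exact e.image_closure _

/-- Exterior equivalent twisted actions have *-isomorphic reduced twisted crossed products:
if `(α,u)` and `(β,v)` are twisted actions of a discrete group `Γ` on `A` with
`β_s = Ad(w_s) ∘ α_s` and `v(s,t) = w_s α_s(w_t) u(s,t) w_{st}*` for unitaries `w_s ∈ M(A)`,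
then the unitary `U` on `K = ℓ²(Γ, H)` given by `U(ξ ⊗ δ_t) = π(w_{t⁻¹})ξ ⊗ δ_t` satisfies
`U (A ⋊_{r,α,u} Γ) U* = A ⋊_{r,β,v} Γ`, with `Ad(U) ∘ π̃_α = π̃_β` and
`U π̃_α(w_g) λ^u_g U* = λ^v_g`. -/
theorem stmt13 {Γ : Type*} [Group Γ] [DecidableEq Γ]
    {A MA : Type*} [NonUnitalCStarAlgebra A] [StarModule ℂ A]
    [CStarAlgebra MA]
    {H : Type*} [NormedAddCommGroup H] [InnerProductSpace ℂ H] [CompleteSpace H]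
    -- `MA` plays the role of the multiplier algebra `M(A)`:
    (ι : A →⋆ₙₐ[ℂ] MA) (hι_inj : Function.Injective ι)
    (hι_ideal : ∀ (m : MA) (a : A), (∃ b : A, ι b = m * ι a) ∧ (∃ b : A, ι b = ι a * m))
    -- the twisted action `(α, u)` with extension `ᾱ` to multipliers:
    (α : Γ → A ≃⋆ₐ[ℂ] A) (ᾱ : Γ → MA ≃⋆ₐ[ℂ] MA)
    (hαcompat : ∀ (s : Γ) (a : A), ᾱ s (ι a) = ι (α s a))
    (u : Γ → Γ → MA) (hu_unitary : ∀ s t, star (u s t) * u s t = 1 ∧ u s t * star (u s t) = 1)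
    (hcocycle₁ : ∀ (s t : Γ) (m : MA), ᾱ s (ᾱ t m) = u s t * ᾱ (s * t) m * star (u s t))
    (hcocycle₂ : ∀ r s t : Γ, ᾱ r (u s t) * u r (s * t) = u r s * u (r * s) t)
    (hcocycle₃ : ∀ s : Γ, u 1 s = 1 ∧ u s 1 = 1)
    -- the exterior equivalence data `w` and the twisted action `(β, v)`:
    (w : Γ → MA) (hw_unitary : ∀ s, star (w s) * w s = 1 ∧ w s * star (w s) = 1)
    (β : Γ → A ≃⋆ₐ[ℂ] A) (β' : Γ → MA ≃⋆ₐ[ℂ] MA)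
    (hβcompat : ∀ (s : Γ) (a : A), β' s (ι a) = ι (β s a))
    (hβ : ∀ (s : Γ) (m : MA), β' s m = w s * ᾱ s m * star (w s))
    (v : Γ → Γ → MA)
    (hv : ∀ s t : Γ, v s t = w s * ᾱ s (w t) * u s t * star (w (s * t)))
    -- a faithful non-degenerate representation of `A` on `H`, extended to `MA`:
    (π : A →⋆ₙₐ[ℂ] (H →L[ℂ] H)) (hπ_inj : Function.Injective π)
    (hπ_nondeg : Dense (Submodule.span ℂ {ξ : H | ∃ (x : A) (η : H), π x η = ξ} : Set H))
    (πM : MA →⋆ₐ[ℂ] (H →L[ℂ] H)) (hπM : ∀ a : A, πM (ι a) = π a)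
    -- the regular representations of `(α,u)` and `(β,v)` on `K = ℓ²(Γ, H)`:
    (Pα Pβ : A → (lp (fun _ : Γ => H) 2 →L[ℂ] lp (fun _ : Γ => H) 2))
    (hPα : ∀ (a : A) (t : Γ) (ξ : H),
      Pα a (lp.single 2 t ξ) = lp.single 2 t (π (α t⁻¹ a) ξ))
    (hPβ : ∀ (a : A) (t : Γ) (ξ : H),
      Pβ a (lp.single 2 t ξ) = lp.single 2 t (π (β t⁻¹ a) ξ))
    (PM : MA → (lp (fun _ : Γ => H) 2 →L[ℂ] lp (fun _ : Γ => H) 2))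
    (hPM : ∀ (m : MA) (t : Γ) (ξ : H),
      PM m (lp.single 2 t ξ) = lp.single 2 t (πM (ᾱ t⁻¹ m) ξ))
    (Lu Lv : Γ → (lp (fun _ : Γ => H) 2 →L[ℂ] lp (fun _ : Γ => H) 2))
    (hLu : ∀ (g t : Γ) (ξ : H),
      Lu g (lp.single 2 t ξ) = lp.single 2 (g * t) (πM (u (t⁻¹ * g⁻¹) g) ξ))
    (hLv : ∀ (g t : Γ) (ξ : H),
      Lv g (lp.single 2 t ξ) = lp.single 2 (g * t) (πM (v (t⁻¹ * g⁻¹) g) ξ))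
    -- the unitary `U`:
    (U : lp (fun _ : Γ => H) 2 →L[ℂ] lp (fun _ : Γ => H) 2)
    (hU : ∀ (t : Γ) (ξ : H), U (lp.single 2 t ξ) = lp.single 2 t (πM (w t⁻¹) ξ)) :
    (star U * U = 1 ∧ U * star U = 1) ∧
    (∀ a : A, U * Pα a * star U = Pβ a) ∧
    (∀ g : Γ, U * (PM (w g) * Lu g) * star U = Lv g) ∧
    (fun x => U * x * star U) ''
        closure (NonUnitalStarAlgebra.adjoin ℂ
          {x | ∃ (a : A) (g : Γ), x = Pα a * Lu g} : Set _) =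
      closure (NonUnitalStarAlgebra.adjoin ℂ
          {x | ∃ (a : A) (g : Γ), x = Pβ a * Lv g} : Set _) := by
  have hUs : ∀ (t : Γ) (ξ : H),
      star U (lp.single 2 t ξ) = lp.single 2 t (πM (star (w t⁻¹)) ξ) := fun t ξ => by
    rw [lp.star_apply_single_of_diagonal (D := fun t => πM (w t⁻¹)) hU, map_star]
  have hπM_mul : ∀ (x y : MA) (ξ : H), πM x (πM y ξ) = πM (x * y) ξ := fun x y ξ => by
    rw [map_mul, mul_apply_eq_comp]
  have hU₁ : star U * U = 1 := lp.clm_ext_single fun t ξ => by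
    rw [mul_apply_eq_comp, hU, hUs, hπM_mul, (hw_unitary _).1, map_one]
    rfl
  have hU₂ : U * star U = 1 := lp.clm_ext_single fun t ξ => by
    rw [mul_apply_eq_comp, hUs, hU, hπM_mul, (hw_unitary _).2, map_one]
    rfl
  have hP : ∀ a : A, U * Pα a * star U = Pβ a := fun a => lp.clm_ext_single fun t ξ => by
    rw [mul_apply_eq_comp, mul_apply_eq_comp, hUs, hPα, hU, hPβ, ← hπM,
      ← hπM, ← hαcompat, ← hβcompat, hβ, hπM_mul, hπM_mul, mul_assoc]
  have hL : ∀ g : Γ, U * (PM (w g) * Lu g) * star U = Lv g := fun g =>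
    lp.clm_ext_single fun t ξ => by
      rw [mul_apply_eq_comp, mul_apply_eq_comp,
        mul_apply_eq_comp, hUs, hLu, hPM, hU, hLv, hv, hπM_mul, hπM_mul, hπM_mul,
        mul_inv_rev, inv_mul_cancel_right]
  have hPM_mul : ∀ (a b : A) (m : MA), ι b = ι a * m → Pα b = Pα a * PM m := fun a b m h =>
    lp.clm_ext_single fun t ξ => by
      rw [mul_apply_eq_comp, hPM, hPα, hPα, ← hπM, ← hπM, hπM_mul, ← hαcompat,
        ← hαcompat, h, map_mul]
  have hgen : ∀ (a b : A) (g : Γ), ι b = ι a * w g →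
      U * (Pα b * Lu g) * star U = Pβ a * Lv g := fun a b g h => by
    rw [← hP, ← hL, hPM_mul a b _ h]
    simp only [mul_assoc]
    rw [← mul_assoc (star U) U, hU₁, one_mul]
  refine ⟨⟨hU₁, hU₂⟩, hP, hL, Unitary.image_conj_closure_adjoin ⟨hU₁, hU₂⟩ ?_⟩
  ext x
  constructor
  · rintro ⟨_, ⟨b, g, rfl⟩, rfl⟩
    obtain ⟨a, ha⟩ := (hι_ideal (star (w g)) b).2
    exact ⟨a, g, hgen a b g (by rw [ha, mul_assoc, (hw_unitary g).1, mul_one])⟩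
  · rintro ⟨a, g, rfl⟩
    obtain ⟨b, hb⟩ := (hι_ideal (w g) a).2
    exact ⟨_, ⟨b, g, rfl⟩, hgen a b g hb⟩
end

section
/- Let τ be a tracial positive linear functional on a C*-algebra A, faithful, with GNS representation π_τ and M = π_τ(A)''. Let a, b ∈ A₊ with ‖a‖, ‖b‖ ≤ 1 and suppose there is a sequence (u_n) of unitaries in M with ‖u_n a u_n* − b‖ → 0. Then for every ε > 0 there exists v ∈ A with ‖v‖ ≤ 1, v v* ∈ Her(b, A), ‖v a v* − b‖_τ < ε, and ‖a^{1/2} v* v a^{1/2} − a‖_τ < √ε. -/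
open scoped ComplexOrder

section TracialVector

open scoped InnerProductSpace

variable {A : Type*} [NonUnitalCStarAlgebra A]
  {H : Type*} [NormedAddCommGroup H] [InnerProductSpace ℂ H] [CompleteSpace H]
  {π : A →⋆ₙₐ[ℂ] (H →L[ℂ] H)} {ξ : H}

theorem map_mul_vec (x y : A) (ζ : H) : π (x * y) ζ = π x (π y ζ) := by
  rw [map_mul]; rfl

theorem inner_map_star (x : A) (ζ η : H) : ⟪π (star x) ζ, η⟫_ℂ = ⟪ζ, π x η⟫_ℂ := by
  rw [map_star, ContinuousLinearMap.star_eq_adjoint, ContinuousLinearMap.adjoint_inner_left]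

theorem inner_map_left (x : A) (ζ η : H) : ⟪π x ζ, η⟫_ℂ = ⟪ζ, π (star x) η⟫_ℂ := by
  rw [← inner_map_star, star_star]

theorem norm_map_le (x : A) (ζ : H) : ‖π x ζ‖ ≤ ‖x‖ * ‖ζ‖ :=
  (π x).le_of_opNorm_le (NonUnitalStarAlgHom.norm_apply_le π x) ζ

theorem norm_map_star_vec (htr : ∀ x y, ⟪ξ, π (x * y) ξ⟫_ℂ = ⟪ξ, π (y * x) ξ⟫_ℂ) (x : A) :
    ‖π (star x) ξ‖ = ‖π x ξ‖ := by
  have h : ⟪π (star x) ξ, π (star x) ξ⟫_ℂ = ⟪π x ξ, π x ξ⟫_ℂ := by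
    rw [inner_map_star, inner_map_left, ← map_mul_vec, ← map_mul_vec, htr]
  rw [inner_self_eq_norm_sq_to_K, inner_self_eq_norm_sq_to_K] at h
  exact (sq_eq_sq₀ (norm_nonneg _) (norm_nonneg _)).1 (by exact_mod_cast h)

theorem norm_map_mul_left_le (x y : A) : ‖π (x * y) ξ‖ ≤ ‖x‖ * ‖π y ξ‖ := by
  rw [map_mul_vec]; exact norm_map_le _ _

theorem norm_map_mul_right_le (htr : ∀ x y, ⟪ξ, π (x * y) ξ⟫_ℂ = ⟪ξ, π (y * x) ξ⟫_ℂ) (x y : A) :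
    ‖π (x * y) ξ‖ ≤ ‖y‖ * ‖π x ξ‖ := by
  rw [← norm_map_star_vec htr, star_mul, ← norm_map_star_vec htr x, ← norm_star y]
  exact norm_map_mul_left_le _ _

/-- Right multiplication by `y`, as a bounded operator in the commutant of `π(A)`. -/
theorem exists_right_mul (hd : DenseRange fun x => π x ξ)
    (htr : ∀ x y, ⟪ξ, π (x * y) ξ⟫_ℂ = ⟪ξ, π (y * x) ξ⟫_ℂ) (y : A) :
    ∃ R ∈ (Set.range π).centralizer, (∀ ζ, ‖R ζ‖ ≤ ‖y‖ * ‖ζ‖) ∧ R ξ = π y ξ ∧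
      star R ξ = π (star y) ξ := by
  let e : A →ₗ[ℂ] H :=
    { toFun := fun x => π x ξ, map_add' := by simp, map_smul' := by simp }
  let f : A →ₗ[ℂ] H :=
    { toFun := fun x => π (x * y) ξ
      map_add' := by simp [add_mul]
      map_smul' := by simp [smul_mul_assoc] }
  have hde : DenseRange e := hd
  have hf : ∀ x, ‖f x‖ ≤ ‖y‖ * ‖e x‖ := fun x => norm_map_mul_right_le htr x y
  have hR : ∀ x, f.extendOfNorm e (π x ξ) = π (x * y) ξ :=
    fun x => LinearMap.extendOfNorm_eq hde ⟨_, hf⟩ x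
  have hle := LinearMap.norm_extendOfNorm_apply_le hde _ hf
  generalize f.extendOfNorm e = R at hR hle
  have hRc : R ∈ (Set.range π).centralizer := by
    rintro _ ⟨x, rfl⟩
    ext ζ
    refine hd.induction_on (p := fun ζ => (π x * R) ζ = (R * π x) ζ) ζ
      (isClosed_eq (by fun_prop) (by fun_prop)) fun z => ?_
    simp only [mul_apply_eq_comp]
    rw [hR, ← map_mul_vec, ← map_mul_vec, hR, mul_assoc]
  have hRs : star R ∈ (Set.range π).centralizer :=
    Set.star_mem_centralizer' (by rintro _ ⟨x, rfl⟩; exact ⟨star x, map_star π x⟩) hRc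
  have hsξ : star R ξ = π (star y) ξ := by
    refine hd.eq_of_inner_left ℂ fun z => ?_
    rw [ContinuousLinearMap.star_eq_adjoint, ContinuousLinearMap.adjoint_inner_left, hR,
      inner_map_star, ← map_mul_vec, htr]
  refine ⟨R, hRc, hle, ?_, hsξ⟩
  refine hd.eq_of_inner_right ℂ fun z => ?_
  have hc : star R (π z ξ) = π z (star R ξ) :=
    (congrArg (fun T : H →L[ℂ] H => T ξ) (hRs _ ⟨z, rfl⟩)).symm
  rw [← ContinuousLinearMap.adjoint_inner_left, ← ContinuousLinearMap.star_eq_adjoint, hc, hsξ,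
    ← map_mul_vec, inner_map_left, inner_map_left, ← map_mul_vec, star_mul, star_star, htr]

theorem star_mem_bicommutant {T : H →L[ℂ] H}
    (hT : T ∈ (Set.range π).centralizer.centralizer) :
    star T ∈ (Set.range π).centralizer.centralizer :=
  Set.star_mem_centralizer' (fun _ => Set.star_mem_centralizer'
    (by rintro _ ⟨x, rfl⟩; exact ⟨star x, map_star π x⟩)) hT

theorem map_mem_bicommutant (x : A) : π x ∈ (Set.range π).centralizer.centralizer :=
  Set.subset_centralizer_centralizer ⟨x, rfl⟩

theorem norm_bicommutant_map_vec_le (hd : DenseRange fun x => π x ξ)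
    (htr : ∀ x y, ⟪ξ, π (x * y) ξ⟫_ℂ = ⟪ξ, π (y * x) ξ⟫_ℂ) {T : H →L[ℂ] H}
    (hT : T ∈ (Set.range π).centralizer.centralizer) (y : A) :
    ‖T (π y ξ)‖ ≤ ‖y‖ * ‖T ξ‖ := by
  obtain ⟨R, hRc, hle, hξ, -⟩ := exists_right_mul hd htr y
  have h : T (R ξ) = R (T ξ) := (congrArg (fun S : H →L[ℂ] H => S ξ) (hT R hRc)).symm
  rw [← hξ, h]
  exact hle _

theorem norm_star_bicommutant_vec_le (hd : DenseRange fun x => π x ξ)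
    (htr : ∀ x y, ⟪ξ, π (x * y) ξ⟫_ℂ = ⟪ξ, π (y * x) ξ⟫_ℂ) {T : H →L[ℂ] H}
    (hT : T ∈ (Set.range π).centralizer.centralizer) :
    ‖star T ξ‖ ≤ ‖T ξ‖ := by
  have key : ∀ ζ : H, ‖⟪star T ξ, ζ⟫_ℂ‖ ≤ ‖T ξ‖ * ‖ζ‖ := fun ζ => by
    refine hd.induction_on (p := fun ζ => ‖⟪star T ξ, ζ⟫_ℂ‖ ≤ ‖T ξ‖ * ‖ζ‖) ζ
      (isClosed_le (by fun_prop) (by fun_prop)) fun y => ?_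
    obtain ⟨R, hRc, -, hξ, hsξ⟩ := exists_right_mul hd htr y
    have h : T (R ξ) = R (T ξ) := (congrArg (fun S : H →L[ℂ] H => S ξ) (hT R hRc)).symm
    rw [ContinuousLinearMap.star_eq_adjoint, ContinuousLinearMap.adjoint_inner_left, ← hξ, h,
      ← ContinuousLinearMap.adjoint_inner_left, ← ContinuousLinearMap.star_eq_adjoint, hsξ, hξ,
      ← norm_map_star_vec htr y, mul_comm]
    exact norm_inner_le_norm _ _
  have h := key (star T ξ)
  rw [inner_self_eq_norm_sq_to_K] at h
  have h' : ‖star T ξ‖ ^ 2 ≤ ‖T ξ‖ * ‖star T ξ‖ := by simpa using h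
  by_contra! hlt
  nlinarith [norm_nonneg (T ξ)]

theorem norm_star_mul_self_vec_sub_le {T : H →L[ℂ] H} (hT : ‖T‖ ≤ 1) (ζ : H) :
    ‖star T (T ζ) - ζ‖ ^ 2 ≤ 2 * (‖ζ‖ ^ 2 - ‖T ζ‖ ^ 2) := by
  have h1 : RCLike.re ⟪star T (T ζ), ζ⟫_ℂ = ‖T ζ‖ ^ 2 := by
    rw [ContinuousLinearMap.star_eq_adjoint, ContinuousLinearMap.adjoint_inner_left,
      inner_self_eq_norm_sq]
  have h2 : ‖star T (T ζ)‖ ≤ ‖T ζ‖ := by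
    simpa using (star T).le_of_opNorm_le ((norm_star T).trans_le hT) (T ζ)
  have h3 : ‖T ζ‖ ≤ ‖ζ‖ := by simpa using T.le_of_opNorm_le hT ζ
  rw [@norm_sub_sq ℂ, h1]
  nlinarith [norm_nonneg (star T (T ζ)), norm_nonneg (T ζ)]

end TracialVector

section Cutoff

variable {A : Type*} [NonUnitalCStarAlgebra A] [PartialOrder A] [StarOrderedRing A]

/-- The contraction `2 m (1 + m* m)⁻¹`, written as `2 (m - m k)` with `k = m* m (1 + m* m)⁻¹`. -/
theorem exists_bounded_transform (m : A) :
    ∃ k : A, ‖k‖ ≤ 1 ∧ k + star m * m * k = star m * m ∧ ‖(2 : ℂ) • (m - m * k)‖ ≤ 1 := by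
  set p := star m * m with hp
  have hp0 : 0 ≤ p := star_mul_self_nonneg m
  have hsa : IsSelfAdjoint p := hp0.isSelfAdjoint
  have hσ : ∀ t ∈ quasispectrum ℝ p, 0 ≤ t := fun t ht => quasispectrum_nonneg_of_nonneg p hp0 t ht
  have hpos : ∀ t ∈ quasispectrum ℝ p, 1 + t ≠ 0 := fun t ht => by linarith [hσ t ht]
  have hc : ContinuousOn (fun t : ℝ => t / (1 + t)) (quasispectrum ℝ p) :=
    continuousOn_id.div (by fun_prop) hpos
  set k := cfcₙ (fun t : ℝ => t / (1 + t)) p with hk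
  have hksa : star k = k := (cfcₙ_predicate (R := ℝ) (p := IsSelfAdjoint) _ p).star_eq
  have hpk : p * k = cfcₙ (fun t : ℝ => t * (t / (1 + t))) p := by
    rw [cfcₙ_mul (fun t : ℝ => t) _ p, cfcₙ_id' ℝ p]
  have h1 : k + p * k = p := by
    rw [hpk, hk, ← cfcₙ_add ..]
    conv_rhs => rw [← cfcₙ_id' ℝ p]
    refine cfcₙ_congr fun t ht => ?_
    have := hpos t ht
    field_simp
  refine ⟨k, norm_cfcₙ_le fun t ht => ?_, h1, ?_⟩
  · have := hσ t ht
    rw [Real.norm_of_nonneg (by positivity), div_le_one (by positivity)]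
    linarith
  have h2 : star (m - m * k) * (m - m * k) = k - k * k := by
    have : star (m - m * k) * (m - m * k) = (p - p * k) - k * (p - p * k) := by
      simp only [star_sub, star_mul, hksa, hp, mul_sub, sub_mul, mul_assoc]
      abel
    rw [this, sub_eq_of_eq_add h1.symm]
  have h3 : k - k * k = cfcₙ (fun t : ℝ => t / (1 + t) - t / (1 + t) * (t / (1 + t))) p := by
    rw [cfcₙ_sub .., cfcₙ_mul ..]
  have h4 : ‖k - k * k‖ ≤ 1 / 4 := by
    rw [h3]
    refine norm_cfcₙ_le fun t ht => ?_
    rw [Real.norm_eq_abs, abs_le]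
    have := hσ t ht
    have h5 : t / (1 + t) ≤ 1 := by rw [div_le_one (by positivity)]; linarith
    have h6 : 0 ≤ t / (1 + t) := by positivity
    constructor <;> nlinarith [sq_nonneg (t / (1 + t) - 1 / 2)]
  rw [← h2, CStarRing.norm_star_mul_self] at h4
  rw [norm_smul, Complex.norm_ofNat]
  nlinarith [norm_nonneg (m - m * k)]

/-- A positive contraction `h` in the range of `x ↦ b x` that almost acts as a unit on `b`. -/
theorem exists_cutoff (b : A) (hb : 0 ≤ b) {κ : ℝ} (hκ : 0 < κ) :
    ∃ h g : A, star h = h ∧ ‖h‖ ≤ 1 ∧ h = b * g ∧ h = g * b ∧ h * b * h = h * h * b ∧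
      ‖b - h * h * b‖ ≤ κ := by
  have hsa : IsSelfAdjoint b := hb.isSelfAdjoint
  have hσ : ∀ t ∈ quasispectrum ℝ b, 0 ≤ t := fun t ht => quasispectrum_nonneg_of_nonneg b hb t ht
  have hne : ∀ t : ℝ, t ^ 2 + κ ^ 2 ≠ 0 := fun t => by positivity
  have hcg : Continuous fun t : ℝ => t / (t ^ 2 + κ ^ 2) := by fun_prop (disch := exact hne _)
  have hid : cfcₙ (fun t : ℝ => t) b = b := cfcₙ_id' ℝ b
  set g := cfcₙ (fun t : ℝ => t / (t ^ 2 + κ ^ 2)) b with hg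
  have hbg : b * g = cfcₙ (fun t : ℝ => t * (t / (t ^ 2 + κ ^ 2))) b := by
    rw [cfcₙ_mul (fun t : ℝ => t) _ b (by fun_prop) rfl hcg.continuousOn, hid]
  have hcomm : b * g = g * b := by
    have := cfcₙ_commute_cfcₙ (fun t : ℝ => t) (fun t : ℝ => t / (t ^ 2 + κ ^ 2)) b
    rw [hid] at this
    exact this
  have hch : Continuous fun t : ℝ => t * (t / (t ^ 2 + κ ^ 2)) := by fun_prop
  have hrange : ∀ t : ℝ, 0 ≤ t * (t / (t ^ 2 + κ ^ 2)) ∧ t * (t / (t ^ 2 + κ ^ 2)) ≤ 1 := fun t => by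
    rw [← mul_div_assoc, ← sq]
    exact ⟨by positivity, by rw [div_le_one (by positivity)]; nlinarith⟩
  refine ⟨b * g, g, ?_, ?_, rfl, hcomm, ?_, ?_⟩
  · rw [hbg]
    exact (cfcₙ_predicate (R := ℝ) (p := IsSelfAdjoint) _ b).star_eq
  · rw [hbg]
    refine norm_cfcₙ_le fun t ht => ?_
    rw [Real.norm_of_nonneg (hrange t).1]
    exact (hrange t).2
  · rw [mul_assoc (b * g) b, mul_assoc (b * g) (b * g), mul_assoc b g b, hcomm]
  have heq : b - b * g * (b * g) * b = cfcₙ (fun t : ℝ =>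
      t - t * (t / (t ^ 2 + κ ^ 2)) * (t * (t / (t ^ 2 + κ ^ 2))) * t) b := by
    rw [cfcₙ_sub (fun t : ℝ => t) _ b, cfcₙ_mul _ (fun t : ℝ => t) b, cfcₙ_mul _ _ b, hid, ← hbg]
  rw [heq]
  refine norm_cfcₙ_le fun t ht => ?_
  have ht := hσ t ht
  obtain ⟨h0, h1⟩ := hrange t
  have hfact : t * (1 - t * (t / (t ^ 2 + κ ^ 2))) ≤ κ / 2 := by
    have : t * (1 - t * (t / (t ^ 2 + κ ^ 2))) = t * κ ^ 2 / (t ^ 2 + κ ^ 2) := by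
      have := hne t
      field_simp
      ring
    rw [this, div_le_div_iff₀ (by positivity) (by norm_num)]
    nlinarith [mul_nonneg hκ.le (sq_nonneg (t - κ))]
  set r := t * (t / (t ^ 2 + κ ^ 2))
  have hnn : 0 ≤ t * (1 - r) := mul_nonneg ht (by linarith)
  have : t - r * r * t = t * (1 - r) * (1 + r) := by ring
  rw [this, Real.norm_of_nonneg (by positivity)]
  nlinarith

end Cutoff

section TracialVector

open scoped InnerProductSpace

variable {A : Type*} [NonUnitalCStarAlgebra A] [PartialOrder A] [StarOrderedRing A]
  {H : Type*} [NormedAddCommGroup H] [InnerProductSpace ℂ H] [CompleteSpace H]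
  {π : A →⋆ₙₐ[ℂ] (H →L[ℂ] H)} {ξ : H}

/-- Kaplansky density at a tracial cyclic vector, for unitaries in the bicommutant. -/
theorem exists_contraction_approx (hd : DenseRange fun x => π x ξ)
    (htr : ∀ x y, ⟪ξ, π (x * y) ξ⟫_ℂ = ⟪ξ, π (y * x) ξ⟫_ℂ) {u : H →L[ℂ] H}
    (hu : u ∈ (Set.range π).centralizer.centralizer) (hu' : u ∈ unitary (H →L[ℂ] H))
    {δ : ℝ} (hδ : 0 < δ) : ∃ x : A, ‖x‖ ≤ 1 ∧ ‖π x ξ - u ξ‖ ≤ δ := by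
  obtain ⟨m, hm⟩ := hd.exists_dist_lt (u ξ) (show 0 < δ / 3 by positivity)
  obtain ⟨k, hk1, hk, hx⟩ := exists_bounded_transform m
  set T := π m - u with hTdef
  have hT : T ∈ (Set.range π).centralizer.centralizer := by
    rw [hTdef, sub_eq_add_neg]
    exact Set.add_mem_centralizer (map_mem_bicommutant m) (Set.neg_mem_centralizer hu)
  have hTξ : ‖T ξ‖ ≤ δ / 3 := by
    rw [dist_comm, dist_eq_norm] at hm
    exact hm.le
  have hmk : ‖m - m * k‖ ≤ 1 / 2 := by
    rw [norm_smul, Complex.norm_ofNat] at hx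
    linarith
  have hp : π (star m) (π m ξ) = π k ξ + π (star m) (π m (π k ξ)) := by
    have := congrArg (fun y => π y ξ) hk
    simpa [map_mul_vec] using this.symm
  have huu : ∀ ζ, u (star u ζ) = ζ := fun ζ =>
    congrArg (fun S : H →L[ℂ] H => S ζ) (Unitary.mem_iff.1 hu').2
  have hid : π ((2 : ℂ) • (m - m * k)) ξ - u ξ =
      (T ξ - T (π k ξ)) - u (star T (π (m - m * k) ξ)) := by
    have hsT : star T = π (star m) - star u := by rw [hTdef, star_sub, map_star]
    rw [hsT, hTdef]
    simp only [map_smul, map_sub, smul_apply, sub_apply,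
      map_mul_vec, huu, hp, map_add]
    module
  refine ⟨_, hx, ?_⟩
  have h1 : ‖T (π k ξ)‖ ≤ δ / 3 :=
    (norm_bicommutant_map_vec_le hd htr hT k).trans
      ((mul_le_of_le_one_left (norm_nonneg _) hk1).trans hTξ)
  have h2 : ‖u (star T (π (m - m * k) ξ))‖ ≤ δ / 3 := by
    rw [ContinuousLinearMap.norm_map_of_mem_unitary hu']
    exact (norm_bicommutant_map_vec_le hd htr (star_mem_bicommutant hT) _).trans
      ((mul_le_of_le_one_left (norm_nonneg _) (hmk.trans (by norm_num))).trans
        ((norm_star_bicommutant_vec_le hd htr hT).trans hTξ))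
  rw [hid]
  calc _ ≤ ‖T ξ‖ + ‖T (π k ξ)‖ + ‖u (star T (π (m - m * k) ξ))‖ :=
        (norm_sub_le _ _).trans (add_le_add_left (norm_sub_le _ _) _)
    _ ≤ δ := by linarith

/-- If `u` conjugates `π(a)` to `π(b)` up to `δ`, then a contraction of `A` close to `u` conjugates
`a` to `b` up to a controlled error in `2`-norm, and is almost isometric and almost coisometric. -/
theorem exists_contraction_conj (hd : DenseRange fun x => π x ξ)
    (htr : ∀ x y, ⟪ξ, π (x * y) ξ⟫_ℂ = ⟪ξ, π (y * x) ξ⟫_ℂ) {u : H →L[ℂ] H}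
    (hu : u ∈ (Set.range π).centralizer.centralizer) (hu' : u ∈ unitary (H →L[ℂ] H))
    {a b : A} (ha : ‖a‖ ≤ 1) (hb : ‖b‖ ≤ 1)
    {δ : ℝ} (hδ : 0 < δ) (hab : ‖u * π a * star u - π b‖ ≤ δ) :
    ∃ x : A, ‖x‖ ≤ 1 ∧
      ‖π (x * a * star x - b) ξ‖ ≤ 2 * δ + δ * ‖ξ‖ + √(4 * ‖ξ‖ * δ) ∧
      ∀ s : A, ‖s‖ ≤ 1 → ‖π (s * (star x * x) * s - s * s) ξ‖ ≤ √(4 * ‖ξ‖ * δ) := by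
  obtain ⟨x, hx, hxu⟩ := exists_contraction_approx hd htr hu hu' hδ
  have hC := norm_nonneg ξ
  have hxξ : ‖ξ‖ ^ 2 - ‖π x ξ‖ ^ 2 ≤ 2 * ‖ξ‖ * δ := by
    have h1 : ‖u ξ‖ = ‖ξ‖ := ContinuousLinearMap.norm_map_of_mem_unitary hu' ξ
    have h2 : ‖ξ‖ - ‖π x ξ‖ ≤ δ := by
      rw [← h1]
      exact (norm_sub_norm_le _ _).trans (by rwa [norm_sub_rev])
    have h3 : ‖π x ξ‖ ≤ ‖ξ‖ :=
      (norm_map_le x ξ).trans (mul_le_of_le_one_left hC hx)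
    nlinarith [norm_nonneg (π x ξ)]
  have hiso : ∀ y : A, ‖y‖ ≤ 1 → ‖π y ξ‖ = ‖π x ξ‖ →
      ‖π (star y * y) ξ - ξ‖ ≤ √(4 * ‖ξ‖ * δ) := fun y hy hyx => by
    refine Real.le_sqrt_of_sq_le ?_
    have := norm_star_mul_self_vec_sub_le ((NonUnitalStarAlgHom.norm_apply_le π y).trans hy) ξ
    rw [hyx, ← map_star, ← map_mul_vec] at this
    linarith
  refine ⟨x, hx, ?_, fun s hs => ?_⟩
  · have hcomm : ‖π (x * a - b * x) ξ‖ ≤ 2 * δ + δ * ‖ξ‖ := by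
      have hT : π x - u ∈ (Set.range π).centralizer.centralizer := by
        rw [sub_eq_add_neg]
        exact Set.add_mem_centralizer (map_mem_bicommutant x) (Set.neg_mem_centralizer hu)
      have h1 : ‖(π x - u) (π a ξ)‖ ≤ δ :=
        (norm_bicommutant_map_vec_le hd htr hT a).trans
          ((mul_le_of_le_one_left (norm_nonneg _) ha).trans hxu)
      have h2 : ‖(u * π a * star u - π b) (u ξ)‖ ≤ δ * ‖ξ‖ := by
        rw [← ContinuousLinearMap.norm_map_of_mem_unitary hu' ξ]
        exact ContinuousLinearMap.le_of_opNorm_le _ hab _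
      have h3 : ‖π b (π x ξ - u ξ)‖ ≤ δ :=
        (norm_map_le _ _).trans ((mul_le_of_le_one_left (norm_nonneg _) hb).trans hxu)
      have huu : star u (u ξ) = ξ :=
        congrArg (fun S : H →L[ℂ] H => S ξ) (Unitary.mem_iff.1 hu').1
      have hid : π (x * a - b * x) ξ = (π x - u) (π a ξ) + (u * π a * star u - π b) (u ξ) -
          π b (π x ξ - u ξ) := by
        simp only [map_sub, sub_apply, map_mul_vec,
          mul_apply_eq_comp, huu]
        abel
      rw [hid]
      calc _ ≤ _ := (norm_sub_le _ _).trans (add_le_add_left (norm_add_le _ _) _)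
        _ ≤ _ := by linarith
    have h1 : ‖π ((x * a - b * x) * star x) ξ‖ ≤ 2 * δ + δ * ‖ξ‖ :=
      (norm_map_mul_right_le htr _ _).trans
        ((mul_le_of_le_one_left (norm_nonneg _) (by rwa [norm_star])).trans hcomm)
    have h2 : ‖π b (π (x * star x) ξ - ξ)‖ ≤ √(4 * ‖ξ‖ * δ) := by
      refine (norm_map_le _ _).trans ((mul_le_of_le_one_left (norm_nonneg _) hb).trans ?_)
      simpa using hiso (star x) (by rwa [norm_star]) (norm_map_star_vec htr x)
    have hid : π (x * a * star x - b) ξ =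
        π ((x * a - b * x) * star x) ξ + π b (π (x * star x) ξ - ξ) := by
      simp only [map_sub, sub_apply, map_mul_vec, sub_mul]
      abel
    rw [hid]
    exact (norm_add_le _ _).trans (add_le_add h1 h2)
  · have hid : π s (π (star x * x) ξ - ξ) = (π s * (π (star x * x) - 1)) ξ := rfl
    have hT : π s * (π (star x * x) - 1) ∈ (Set.range π).centralizer.centralizer := by
      rw [sub_eq_add_neg]
      exact Set.mul_mem_centralizer (map_mem_bicommutant s)
        (Set.add_mem_centralizer (map_mem_bicommutant _)
          (Set.neg_mem_centralizer (Set.one_mem_centralizer)))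
    have heq : π (s * (star x * x) * s - s * s) ξ = (π s * (π (star x * x) - 1)) (π s ξ) := by
      simp
    rw [heq]
    refine (norm_bicommutant_map_vec_le hd htr hT s).trans
      ((mul_le_of_le_one_left (norm_nonneg _) hs).trans ?_)
    rw [← hid]
    exact (norm_map_le _ _).trans ((mul_le_of_le_one_left (norm_nonneg _) hs).trans
      (hiso x hx rfl))

/-- Cutting a contraction `x` down by `h` with `h² b ≈ b` keeps `x a^{1/2} ≈ h² x a^{1/2}`. -/
theorem norm_sub_cutoff_mul_sq_le
    (htr : ∀ x y, ⟪ξ, π (x * y) ξ⟫_ℂ = ⟪ξ, π (y * x) ξ⟫_ℂ) {x s b q : A}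
    (hs : star s = s) (hq : star q = q) (hq1 : ‖q‖ ≤ 1) {δ κ : ℝ}
    (hx : ‖π (x * (s * s) * star x - b) ξ‖ ≤ δ) (hκ : ‖b - q * b‖ ≤ κ) :
    ‖π (x * s - q * (x * s)) ξ‖ ^ 2 ≤ ‖ξ‖ * (4 * δ + 2 * (κ * ‖ξ‖)) := by
  set y := x * s - q * (x * s) with hy
  set d := x * (s * s) * star x - b with hd
  set e := b - q * b with he
  have hyy : y * star y = (d - q * d - (d - q * d) * q) + (e - e * q) := by
    simp only [hy, hd, he, star_sub, star_mul, hs, hq, mul_sub, sub_mul, mul_assoc]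
    abel
  have hl : ∀ z : A, ‖π (q * z) ξ‖ ≤ ‖π z ξ‖ := fun z =>
    (norm_map_mul_left_le q z).trans (mul_le_of_le_one_left (norm_nonneg _) hq1)
  have hr : ∀ z : A, ‖π (z * q) ξ‖ ≤ ‖π z ξ‖ := fun z =>
    (norm_map_mul_right_le htr z q).trans (mul_le_of_le_one_left (norm_nonneg _) hq1)
  have hsub : ∀ z w : A, ‖π (z - w) ξ‖ ≤ ‖π z ξ‖ + ‖π w ξ‖ := fun z w => by
    rw [map_sub]; exact norm_sub_le _ _
  have hadd : ∀ z w : A, ‖π (z + w) ξ‖ ≤ ‖π z ξ‖ + ‖π w ξ‖ := fun z w => by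
    rw [map_add]; exact norm_add_le _ _
  have heξ : ‖π e ξ‖ ≤ κ * ‖ξ‖ :=
    (norm_map_le e ξ).trans (mul_le_mul_of_nonneg_right hκ (norm_nonneg _))
  have hN : ‖π (y * star y) ξ‖ ≤ 4 * δ + 2 * (κ * ‖ξ‖) := by
    rw [hyy]
    linarith [hadd (d - q * d - (d - q * d) * q) (e - e * q), hsub (d - q * d) ((d - q * d) * q),
      hsub e (e * q), hr e, hr (d - q * d), hsub d (q * d), hl d]
  calc ‖π y ξ‖ ^ 2 = ‖π (star y) ξ‖ ^ 2 := by rw [norm_map_star_vec htr]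
    _ = ‖⟪π (star y) ξ, π (star y) ξ⟫_ℂ‖ := by rw [inner_self_eq_norm_sq_to_K]; simp
    _ = ‖⟪ξ, π (y * star y) ξ⟫_ℂ‖ := by rw [inner_map_star, ← map_mul_vec]
    _ ≤ ‖ξ‖ * ‖π (y * star y) ξ‖ := norm_inner_le_norm _ _
    _ ≤ _ := mul_le_mul_of_nonneg_left hN (norm_nonneg _)

end TracialVector

theorem tracial_comm {A : Type*} [NonUnitalCStarAlgebra A] (τ : A →L[ℂ] ℂ)
    (hτ : ∀ x : A, τ (star x * x) = τ (x * star x)) (x y : A) : τ (x * y) = τ (y * x) := by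
  have h1 := hτ (star x + y)
  have h2 := hτ (star x + Complex.I • y)
  have hx := hτ (star x)
  have hy := hτ y
  simp only [star_add, star_star, star_smul, add_mul, mul_add, map_add, smul_mul_assoc,
    mul_smul_comm, map_smul, smul_eq_mul, Complex.star_def, Complex.conj_I] at h1 h2 hx hy
  have h3 : 2 * Complex.I * (τ (x * y) - τ (y * x)) = 0 := by
    linear_combination Complex.I * h1 + h2 - (Complex.I + 1) * hx - (Complex.I + 1) * hy +
      (τ (star y * y) - τ (y * star y)) * Complex.I_sq
  simpa [sub_eq_zero] using h3

/-- Let `τ` be a faithful tracial positive linear functional on a C*-algebra `A` with GNS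
representation `π` (with cyclic vector `ξ`) and `M = π(A)''`.  If `a, b ∈ A₊` are contractions
and there is a sequence `(uₙ)` of unitaries in `M` with `‖uₙ π(a) uₙ* − π(b)‖ → 0`, then for
every `ε > 0` there exists `v ∈ A` with `‖v‖ ≤ 1`, `v v* ∈ Her(b, A)`,
`‖v a v* − b‖_τ < ε`, and `‖a^{1/2} v* v a^{1/2} − a‖_τ < √ε`. -/
theorem stmt15 {A : Type*} [NonUnitalCStarAlgebra A] [PartialOrder A] [StarOrderedRing A]
    [StarModule ℂ A]
    {H : Type*} [NormedAddCommGroup H] [InnerProductSpace ℂ H] [CompleteSpace H]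
    (τ : A →L[ℂ] ℂ) (hτ_pos : ∀ x : A, 0 ≤ x → 0 ≤ τ x)
    (hτ_tracial : ∀ x : A, τ (star x * x) = τ (x * star x))
    (hτ_faithful : ∀ x : A, 0 ≤ x → τ x = 0 → x = 0)
    (π : A →⋆ₙₐ[ℂ] (H →L[ℂ] H)) (hπ_inj : Function.Injective π)
    (ξ : H)
    (hξ_cyclic : Dense (Submodule.span ℂ {η : H | ∃ x : A, π x ξ = η} : Set H))
    (hGNS : ∀ x : A, τ x = inner (𝕜 := ℂ) ξ (π x ξ))
    (a b : A) (ha : 0 ≤ a) (ha1 : ‖a‖ ≤ 1) (hb : 0 ≤ b) (hb1 : ‖b‖ ≤ 1)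
    (u : ℕ → (H →L[ℂ] H))
    (hu_mem : ∀ n, ∀ y : H →L[ℂ] H, (∀ x : A, Commute (π x) y) → Commute (u n) y)
    (hu_unitary : ∀ n, star (u n) * u n = 1 ∧ u n * star (u n) = 1)
    (hu_conv : Filter.Tendsto (fun n => ‖u n * π a * star (u n) - π b‖)
      Filter.atTop (nhds 0)) :
    ∀ ε : ℝ, 0 < ε → ∃ v : A, ‖v‖ ≤ 1 ∧
      v * star v ∈ closure {x : A | ∃ d : A, x = b * d * b} ∧
      Real.sqrt ((τ (star (v * a * star v - b) * (v * a * star v - b))).re) < ε ∧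
      Real.sqrt ((τ (star (CFC.sqrt a * (star v * v) * CFC.sqrt a - a) *
        (CFC.sqrt a * (star v * v) * CFC.sqrt a - a))).re) < Real.sqrt ε := by
  have htr : ∀ x y, inner (𝕜 := ℂ) ξ (π (x * y) ξ) = inner (𝕜 := ℂ) ξ (π (y * x) ξ) :=
    fun x y => by rw [← hGNS, ← hGNS, tracial_comm τ hτ_tracial]
  have hd : DenseRange fun x => π x ξ := by
    let e : A →ₗ[ℂ] H :=
      { toFun := fun x => π x ξ, map_add' := by simp, map_smul' := by simp }
    have hspan : Submodule.span ℂ {η : H | ∃ x : A, π x ξ = η} = LinearMap.range e :=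
      Submodule.span_eq (LinearMap.range e)
    rw [hspan] at hξ_cyclic
    exact hξ_cyclic
  have hnorm : ∀ w : A, √((τ (star w * w)).re) = ‖π w ξ‖ := fun w => by
    rw [hGNS, map_mul_vec, ← inner_map_left, inner_self_eq_norm_sq_to_K]
    norm_cast
    exact Real.sqrt_sq (norm_nonneg _)
  intro ε hε
  obtain ⟨t, ht1, ht2, ht⟩ : ∃ t : ℝ,
      2 * t + t * ‖ξ‖ + √(4 * ‖ξ‖ * t) + t * ‖ξ‖ < ε ∧
      √(4 * ‖ξ‖ * t) + √(‖ξ‖ * (4 * (2 * t + t * ‖ξ‖ + √(4 * ‖ξ‖ * t)) + 2 * (t * ‖ξ‖))) < √ε ∧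
      0 < t := by
    have h1 : Filter.Tendsto (fun t : ℝ => 2 * t + t * ‖ξ‖ + √(4 * ‖ξ‖ * t) + t * ‖ξ‖)
        (nhdsWithin 0 (Set.Ioi 0)) (nhds 0) :=
      tendsto_nhdsWithin_of_tendsto_nhds (Continuous.tendsto' (by fun_prop) _ _ (by simp))
    have h2 : Filter.Tendsto (fun t : ℝ => √(4 * ‖ξ‖ * t) +
        √(‖ξ‖ * (4 * (2 * t + t * ‖ξ‖ + √(4 * ‖ξ‖ * t)) + 2 * (t * ‖ξ‖))))
        (nhdsWithin 0 (Set.Ioi 0)) (nhds 0) :=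
      tendsto_nhdsWithin_of_tendsto_nhds (Continuous.tendsto' (by fun_prop) _ _ (by simp))
    exact ((h1.eventually_lt_const hε).and ((h2.eventually_lt_const (Real.sqrt_pos.2 hε)).and
      self_mem_nhdsWithin)).exists
  obtain ⟨n, hn⟩ := (hu_conv.eventually_lt_const ht).exists
  have hu : u n ∈ (Set.range π).centralizer.centralizer := fun y hy =>
    (hu_mem n y fun x => hy _ ⟨x, rfl⟩).symm
  obtain ⟨x, hx, hxab, hxs⟩ :=
    exists_contraction_conj hd htr hu (Unitary.mem_iff.2 (hu_unitary n)) ha1 hb1 ht hn.le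
  obtain ⟨h, g, hsa, h1, hbg, hgb, hbh, hκ⟩ := exists_cutoff b hb ht
  set s := CFC.sqrt a
  have hss : s * s = a := CFC.sqrt_mul_sqrt_self a ha
  have hs_sa : star s = s := (CFC.sqrt_nonneg a).isSelfAdjoint.star_eq
  have hs1 : ‖s‖ ≤ 1 := by
    have := CStarRing.norm_star_mul_self (x := s)
    rw [hs_sa, hss] at this
    nlinarith [norm_nonneg s]
  have hq1 : ‖h * h‖ ≤ 1 :=
    (norm_mul_le _ _).trans (mul_le_one₀ h1 (norm_nonneg _) h1)
  refine ⟨h * x, (norm_mul_le _ _).trans (mul_le_one₀ h1 (norm_nonneg _) hx),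
    subset_closure ⟨g * (x * star x) * g, ?_⟩, ?_, ?_⟩
  · calc h * x * star (h * x) = h * (x * star x) * h := by
          rw [star_mul, hsa]; simp only [mul_assoc]
      _ = (b * g) * (x * star x) * (g * b) := by rw [← hbg, ← hgb]
      _ = _ := by simp only [mul_assoc]
  · rw [hnorm]
    have hid : h * x * a * star (h * x) - b =
        h * (x * a * star x - b) * h - (b - h * h * b) := by
      rw [← hbh, star_mul, hsa]
      simp only [mul_sub, sub_mul, mul_assoc]
      abel
    have hmain : ‖π (h * (x * a * star x - b) * h) ξ‖ ≤ ‖π (x * a * star x - b) ξ‖ :=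
      (norm_map_mul_right_le htr _ _).trans ((mul_le_of_le_one_left (norm_nonneg _) h1).trans
        ((norm_map_mul_left_le _ _).trans (mul_le_of_le_one_left (norm_nonneg _) h1)))
    have herr : ‖π (b - h * h * b) ξ‖ ≤ t * ‖ξ‖ :=
      (norm_map_le _ _).trans (mul_le_mul_of_nonneg_right hκ (norm_nonneg _))
    rw [hid, map_sub π (h * (x * a * star x - b) * h)]
    refine ((norm_sub_le _ _).trans (add_le_add (hmain.trans hxab) herr)).trans_lt ht1
  · rw [hnorm]
    have hid : s * (star (h * x) * (h * x)) * s - a =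
        (s * (star x * x) * s - s * s) - s * star x * (x * s - h * h * (x * s)) := by
      rw [← hss, star_mul, hsa]
      simp only [mul_sub, mul_assoc]
      abel
    have hsx : ‖s * star x‖ ≤ 1 :=
      (norm_mul_le _ _).trans (mul_le_one₀ hs1 (norm_nonneg _) (by rwa [norm_star]))
    rw [← hss] at hxab
    have hcut := Real.le_sqrt_of_sq_le
      (norm_sub_cutoff_mul_sq_le htr hs_sa (by rw [star_mul, hsa]) hq1 hxab hκ)
    have herr : ‖π (s * star x * (x * s - h * h * (x * s))) ξ‖ ≤ _ :=
      (norm_map_mul_left_le _ _).trans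
        ((mul_le_of_le_one_left (norm_nonneg _) hsx).trans hcut)
    rw [hid, map_sub π (s * (star x * x) * s - s * s)]
    exact ((norm_sub_le _ _).trans (add_le_add (hxs s hs1) herr)).trans_lt ht2
end
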